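/- For every fixed x ∈ ℝ^d, the function μ ↦ ψ(x;μ) is convex on ℝ^d. -/

import Mathlib

open MeasureTheory Real Filter Matrix

/-- Standard normal density on ℝ. -/
noncomputable def stdPdf (t : ℝ) : ℝ := (Real.sqrt (2 * Real.pi))⁻¹ * Real.exp (-t ^ 2 / 2)

/-- Standard normal cumulative distribution function Φ. -/
noncomputable def Phi (t : ℝ) : ℝ := ∫ s in Set.Iic t, stdPdf s

/-- Standard `d`-dimensional normal density φ_d(x) = (2π)^{-d/2} exp(-‖x‖²/2). -/
noncomputable def phiD {d : ℕ} (x : Fin d → ℝ) : ℝ :=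
  ((Real.sqrt (2 * Real.pi)) ^ d)⁻¹ * Real.exp (-(∑ i, x i ^ 2) / 2)

/-- The sequential bound l̃_k(x) = (l_k − Σ_{j<k} L_{kj} x_j)/L_{kk}
    (and likewise ũ_k(x) upon replacing `l` by `u`). -/
noncomputable def lTil {d : ℕ} (L : Matrix (Fin d) (Fin d) ℝ) (l : Fin d → ℝ)
    (x : Fin d → ℝ) (k : Fin d) : ℝ :=
  (l k - ∑ j ∈ Finset.Iio k, L k j * x j) / L k k

/-- The polytope 𝒞 = {x : l ≤ Lx ≤ u}. -/
def Cset {d : ℕ} (L : Matrix (Fin d) (Fin d) ℝ) (l u : Fin d → ℝ) : Set (Fin d → ℝ) :=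
  {x | ∀ i, l i ≤ L.mulVec x i ∧ L.mulVec x i ≤ u i}

/-- ψ(x;μ) = −xᵀμ + ‖μ‖²/2 + Σ_k log(Φ(ũ_k(x) − μ_k) − Φ(l̃_k(x) − μ_k)). -/
noncomputable def psi {d : ℕ} (L : Matrix (Fin d) (Fin d) ℝ) (l u : Fin d → ℝ)
    (x μ : Fin d → ℝ) : ℝ :=
  -(∑ i, x i * μ i) + (∑ i, μ i ^ 2) / 2 +
    ∑ k, Real.log (Phi (lTil L u x k - μ k) - Phi (lTil L l x k - μ k))

/-- Sequential importance-sampling density g(x;μ). -/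
noncomputable def gdens {d : ℕ} (L : Matrix (Fin d) (Fin d) ℝ) (l u : Fin d → ℝ)
    (x μ : Fin d → ℝ) : ℝ :=
  ∏ k, stdPdf (x k - μ k) *
      (if lTil L l x k ≤ x k ∧ x k ≤ lTil L u x k then (1 : ℝ) else 0) /
      (Phi (lTil L u x k - μ k) - Phi (lTil L l x k - μ k))

/-- ℓ = ∫_𝒞 φ_d(x) dx. -/
noncomputable def lval {d : ℕ} (L : Matrix (Fin d) (Fin d) ℝ) (l u : Fin d → ℝ) : ℝ :=
  ∫ x in Cset L l u, phiD x

/-- The logarithm of the moment generating function of a continuous positive weight on a compact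
interval is convex. -/
lemma convexOn_log_integral_exp_mul {w : ℝ → ℝ} (hw : Continuous w) (hpos : ∀ s, 0 < w s)
    {a b : ℝ} (hab : a < b) :
    ConvexOn ℝ Set.univ (fun m : ℝ => Real.log (∫ s in a..b, Real.exp (s * m) * w s)) := by
  have hint : ∀ m : ℝ, IntervalIntegrable (fun s => Real.exp (s * m) * w s) volume a b :=
    fun m => (by fun_prop : Continuous fun s => Real.exp (s * m) * w s).intervalIntegrable a b
  have hZ : ∀ m : ℝ, 0 < ∫ s in a..b, Real.exp (s * m) * w s := fun m =>
    intervalIntegral.intervalIntegral_pos_of_pos (hint m) (fun s => mul_pos (Real.exp_pos _) (hpos s)) hab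
  refine ⟨convex_univ, fun m _ n _ θ η hθ hη hsum => ?_⟩
  simp only [smul_eq_mul]
  set A := Real.log (∫ s in a..b, Real.exp (s * m) * w s)
  set B := Real.log (∫ s in a..b, Real.exp (s * n) * w s)
  have hZA : ∫ s in a..b, Real.exp (s * m) * w s = Real.exp A := (Real.exp_log (hZ m)).symm
  have hZB : ∫ s in a..b, Real.exp (s * n) * w s = Real.exp B := (Real.exp_log (hZ n)).symm
  rw [Real.log_le_iff_le_exp (hZ _)]
  calc ∫ s in a..b, Real.exp (s * (θ * m + η * n)) * w s
      ≤ ∫ s in a..b, (Real.exp (θ * A + η * B) * θ * Real.exp (-A) * (Real.exp (s * m) * w s)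
          + Real.exp (θ * A + η * B) * η * Real.exp (-B) * (Real.exp (s * n) * w s)) := by
        refine intervalIntegral.integral_mono_on hab.le (hint _)
          (((hint m).const_mul _).add ((hint n).const_mul _)) fun s _ => ?_
        have h := convexOn_exp.2 (Set.mem_univ (s * m - A)) (Set.mem_univ (s * n - B)) hθ hη hsum
        simp only [smul_eq_mul, sub_eq_add_neg, Real.exp_add] at h
        have h₁ : Real.exp (s * (θ * m + η * n)) = Real.exp (θ * A + η * B) *
            Real.exp (θ * (s * m - A) + η * (s * n - B)) := by
          rw [← Real.exp_add]; ring_nf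
        have h₂ := mul_le_mul_of_nonneg_left (mul_le_mul_of_nonneg_right h (hpos s).le)
          (Real.exp_pos (θ * A + η * B)).le
        rw [h₁]
        simp only [sub_eq_add_neg, Real.exp_add] at h₂ ⊢
        linarith
    _ = Real.exp (θ * A + η * B) := by
        rw [intervalIntegral.integral_add ((hint m).const_mul _) ((hint n).const_mul _),
          intervalIntegral.integral_const_mul,
          intervalIntegral.integral_const_mul, hZA, hZB,
          mul_assoc _ (Real.exp (-A)), mul_assoc _ (Real.exp (-B)),
          ← Real.exp_add, ← Real.exp_add, neg_add_cancel, neg_add_cancel, Real.exp_zero,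
          mul_one, mul_one, ← mul_add, hsum, mul_one]

lemma stdPdf_pos (t : ℝ) : 0 < stdPdf t := by
  unfold stdPdf; positivity

lemma continuous_stdPdf : Continuous stdPdf := by
  unfold stdPdf; fun_prop

lemma integrable_stdPdf : Integrable stdPdf := by
  refine ((integrable_exp_neg_mul_sq (b := 1 / 2) (by norm_num)).const_mul
    (Real.sqrt (2 * Real.pi))⁻¹).congr (ae_of_all _ fun t => ?_)
  simp only [stdPdf]
  ring_nf

/-- The mass of a shifted normal law on an interval, by exponential tilting. -/
lemma Phi_sub_sub_Phi_sub (a b m : ℝ) :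
    Phi (b - m) - Phi (a - m) =
      Real.exp (-m ^ 2 / 2) * ∫ s in a..b, Real.exp (s * m) * stdPdf s := by
  unfold Phi
  rw [intervalIntegral.integral_Iic_sub_Iic integrable_stdPdf.integrableOn
    integrable_stdPdf.integrableOn, ← intervalIntegral.integral_comp_sub_right stdPdf m,
    ← intervalIntegral.integral_const_mul]
  refine intervalIntegral.integral_congr fun s _ => ?_
  simp only [stdPdf]
  rw [mul_left_comm (Real.exp (s * m)), mul_left_comm, ← Real.exp_add, ← Real.exp_add]
  ring_nf

lemma convexOn_sq_half_add_log_Phi_sub {a b : ℝ} (hab : a < b) :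
    ConvexOn ℝ Set.univ
      (fun m : ℝ => m ^ 2 / 2 + Real.log (Phi (b - m) - Phi (a - m))) := by
  refine (convexOn_log_integral_exp_mul continuous_stdPdf stdPdf_pos hab).congr fun m _ => ?_
  have hZ : 0 < ∫ s in a..b, Real.exp (s * m) * stdPdf s :=
    intervalIntegral.intervalIntegral_pos_of_pos
      (((by fun_prop : Continuous fun s : ℝ => Real.exp (s * m)).mul
        continuous_stdPdf).intervalIntegrable a b)
      (fun s => mul_pos (Real.exp_pos _) (stdPdf_pos s)) hab
  simp only [Phi_sub_sub_Phi_sub]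
  rw [Real.log_mul (Real.exp_pos _).ne' hZ.ne', Real.log_exp]
  ring

/-- for every fixed x, μ ↦ ψ(x;μ) is convex on ℝ^d. -/
theorem psi_convex_in_mu {d : ℕ} (hd : 1 ≤ d)
    (L : Matrix (Fin d) (Fin d) ℝ)
    (hLow : ∀ i j : Fin d, i < j → L i j = 0)
    (hDiag : ∀ i, 0 < L i i)
    (l u : Fin d → ℝ) (hlu : ∀ k, l k < u k)
    (x : Fin d → ℝ) :
    ConvexOn ℝ Set.univ (fun μ => psi L l u x μ) := by
  refine ⟨convex_univ, fun μ _ ν _ θ η hθ hη hsum => ?_⟩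
  have hpsi : ∀ μ : Fin d → ℝ, psi L l u x μ = ∑ k, (-(x k * μ k) + (μ k ^ 2 / 2 +
      Real.log (Phi (lTil L u x k - μ k) - Phi (lTil L l x k - μ k)))) := fun μ => by
    simp only [psi, Finset.sum_add_distrib, Finset.sum_neg_distrib, Finset.sum_div]
    ring
  simp only [hpsi, smul_eq_mul, Finset.mul_sum, ← Finset.sum_add_distrib]
  refine Finset.sum_le_sum fun k _ => ?_
  have hlt : lTil L l x k < lTil L u x k :=
    div_lt_div_of_pos_right (sub_lt_sub_right (hlu k) _) (hDiag k)
  have h := (convexOn_sq_half_add_log_Phi_sub hlt).2 (Set.mem_univ (μ k)) (Set.mem_univ (ν k))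
    hθ hη hsum
  simp only [smul_eq_mul, Pi.add_apply, Pi.smul_apply] at h ⊢
  linarith
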